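/- Lemma (Lemma 5.6). Let Q ⊆ V be a full-dimensional simple polytope, and for i ∈ ℕ let 𝒜^i(Q) ⊆ 𝒜(Q) denote the image of the space of homogeneous polynomials of degree i in ℝ[X_F : F ∈ 𝔉(Q)] under the quotient map (each variable X_F having degree 1). Then 𝒜(Q) is a Poincaré duality algebra over ℝ with top degree n: 𝒜^i(Q) = 0 for all i > n; dim_ℝ 𝒜^n(Q) = 1; and for every 0 ≤ i ≤ n the multiplication pairing 𝒜^i(Q) × 𝒜^{n−i}(Q) → 𝒜^n(Q) is non-degenerate, i.e. for every nonzero a ∈ 𝒜^i(Q) there exists b ∈ 𝒜^{n−i}(Q) with a·b ≠ 0. -/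

import Mathlib

open scoped RealInnerProductSpace

noncomputable section

variable {V : Type*} [NormedAddCommGroup V] [InnerProductSpace ℝ V]

/-- The reflection `r_α` across the hyperplane orthogonal to `α`:
`r_α(x) = x − (2⟪x,α⟫/⟪α,α⟫) α`. -/
def reflMap (α : V) : V → V := fun x => x - (2 * ⟪x, α⟫ / ⟪α, α⟫) • α

/-- The hyperplane `H_α = {x | ⟪x, α⟫ = 0}` fixed by `reflMap α`. -/
def hplane (α : V) : Set V := {x : V | ⟪x, α⟫ = 0}

/-- `F` is a facet of the full-dimensional polytope `Q`: an exposed face whose affine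
span has dimension `n − 1` (where `n = dim V`). -/
def IsFacet (Q F : Set V) : Prop :=
  IsExposed ℝ Q F ∧ Module.finrank ℝ (affineSpan ℝ F).direction + 1 = Module.finrank ℝ V

open Classical in
/-- The barycenter of a nonempty face: the centroid of its finitely many extreme points. -/
def barycenter (F : Set V) : V :=
  if h : (Set.extremePoints ℝ F).Finite then h.toFinset.centroid ℝ id else 0

/-- A full-dimensional polytope is simple if every extreme point lies in exactly `n` facets. -/
def IsSimple (Q : Set V) : Prop :=
  ∀ v ∈ Set.extremePoints ℝ Q, {F : Set V | IsFacet Q F ∧ v ∈ F}.ncard = Module.finrank ℝ V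

/-- The type of facets of `Q`. -/
abbrev Facets (Q : Set V) := {F : Set V // IsFacet Q F}

/-- `u` is the unit outward normal of the facet `F` of `Q`. -/
def IsOutwardNormal (Q F : Set V) (u : V) : Prop :=
  ‖u‖ = 1 ∧ F = {x ∈ Q | ∀ y ∈ Q, ⟪u, y⟫ ≤ ⟪u, x⟫}

open Classical in
/-- The unit outward normal `ℓ_F` of a facet `F` of `Q`. -/
def normalVec (Q F : Set V) : V :=
  if h : ∃ u : V, IsOutwardNormal Q F u then h.choose else 0

/-- The Stanley–Reisner ideal `I_Q`, generated by the square-free monomials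
`X_{F_1} ⋯ X_{F_p}` with `F_1 ∩ ⋯ ∩ F_p = ∅`. -/
def srIdeal (Q : Set V) : Ideal (MvPolynomial (Facets Q) ℝ) :=
  Ideal.span {p | ∃ t : Finset (Facets Q), (⋂ F ∈ t, (F.1 : Set V)) = ∅ ∧
    p = ∏ F ∈ t, MvPolynomial.X F}

/-- The ideal `J_Q` generated by the linear forms `∑_F ⟪u, ℓ_F⟫ X_F` for `u ∈ V`. -/
def linIdeal (Q : Set V) : Ideal (MvPolynomial (Facets Q) ℝ) :=
  Ideal.span {p | ∃ u : V,
    p = ∑ᶠ F : Facets Q, MvPolynomial.C ⟪u, normalVec Q F.1⟫ * MvPolynomial.X F}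

/-- The ideal `I_Q + J_Q`. -/
def polyIdeal (Q : Set V) : Ideal (MvPolynomial (Facets Q) ℝ) := srIdeal Q + linIdeal Q

/-- The polytopal algebra `𝒜(Q) = ℝ[X_F : F ∈ 𝔉(Q)]/(I_Q + J_Q)`. -/
abbrev PolyAlg (Q : Set V) := MvPolynomial (Facets Q) ℝ ⧸ polyIdeal Q

/-- The quotient map onto the polytopal algebra. -/
def polyMk (Q : Set V) : MvPolynomial (Facets Q) ℝ →ₐ[ℝ] PolyAlg Q :=
  Ideal.Quotient.mkₐ ℝ (polyIdeal Q)

/-- The invariant subalgebra of an action `ρ` of a monoid `G` by `ℝ`-algebra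
automorphisms: the elements fixed by every `ρ g`. -/
def invariants {A : Type*} [CommRing A] [Algebra ℝ A] {G : Type*} [Monoid G]
    (ρ : G →* (A ≃ₐ[ℝ] A)) : Subalgebra ℝ A where
  carrier := {a : A | ∀ g : G, ρ g a = a}
  mul_mem' := fun {a b} ha hb g => by
    simp only [Set.mem_setOf_eq] at ha hb ⊢
    rw [map_mul, ha g, hb g]
  one_mem' := fun g => map_one (ρ g)
  add_mem' := fun {a b} ha hb g => by
    simp only [Set.mem_setOf_eq] at ha hb ⊢
    rw [map_add, ha g, hb g]
  zero_mem' := fun g => map_zero (ρ g)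
  algebraMap_mem' := fun r g => (ρ g).commutes r

/-- The degree-`i` piece `𝒜^i(Q)`: the image in `𝒜(Q)` of the homogeneous
polynomials of degree `i` (each variable `X_F` having degree `1`). -/
noncomputable def gradePiece (Q : Set V) (i : ℕ) : Submodule ℝ (PolyAlg Q) :=
  (MvPolynomial.homogeneousSubmodule (Facets Q) ℝ i).map (polyMk Q).toLinearMap

namespace HPolytope

variable {V ι : Type*} [NormedAddCommGroup V] [InnerProductSpace ℝ V] [Fintype ι]

/-- The polyhedron cut out by the inequalities `⟪ℓ i, x⟫ ≤ h i`. -/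
def poly (ℓ : ι → V) (h : ι → ℝ) : Set V := {x | ∀ i, ⟪ℓ i, x⟫ ≤ h i}

open Classical in
/-- The indices of the inequalities that are equalities at `x`. -/
def active (ℓ : ι → V) (h : ι → ℝ) (x : V) : Finset ι := {i | ⟪ℓ i, x⟫ = h i}

variable {ℓ : ι → V} {h : ι → ℝ}

lemma mem_active {x : V} {i : ι} : i ∈ active ℓ h x ↔ ⟪ℓ i, x⟫ = h i := by simp [active]

open Filter Topology in
lemma eventually_mem_poly {v d : V} (hv : v ∈ poly ℓ h)
    (hd : ∀ i ∈ active ℓ h v, ⟪ℓ i, d⟫ ≤ 0) : ∀ᶠ ε : ℝ in 𝓝[>] 0, v + ε • d ∈ poly ℓ h := by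
  refine eventually_all.2 fun i => ?_
  by_cases hi : i ∈ active ℓ h v
  · filter_upwards [self_mem_nhdsWithin] with ε hε
    rw [inner_add_right, inner_smul_right, mem_active.1 hi]
    have := mul_nonpos_of_nonneg_of_nonpos (le_of_lt hε) (hd i hi)
    linarith
  · have hlt : ⟪ℓ i, v + (0 : ℝ) • d⟫ < h i := by
      simpa using lt_of_le_of_ne (hv i) fun h => hi (mem_active.2 h)
    have hc : Continuous fun ε : ℝ => ⟪ℓ i, v + ε • d⟫ := by fun_prop
    exact ((hc.continuousAt.eventually_lt_const hlt).filter_mono nhdsWithin_le_nhds).mono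
      fun ε hε => hε.le

lemma exists_pos_mem_poly {v d : V} (hv : v ∈ poly ℓ h)
    (hd : ∀ i ∈ active ℓ h v, ⟪ℓ i, d⟫ ≤ 0) : ∃ ε : ℝ, 0 < ε ∧ v + ε • d ∈ poly ℓ h := by
  obtain ⟨ε, h1, h2⟩ := ((eventually_mem_poly hv hd).and self_mem_nhdsWithin).exists
  exact ⟨ε, h2, h1⟩

lemma eq_zero_of_forall_inner_eq_zero {v d : V} (hv : v ∈ (poly ℓ h).extremePoints ℝ)
    (hd : ∀ i ∈ active ℓ h v, ⟪ℓ i, d⟫ = 0) : d = 0 := by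
  obtain ⟨ε, ⟨h1, h2⟩, hε⟩ := (((eventually_mem_poly hv.1 fun i hi => (hd i hi).le).and
    (eventually_mem_poly (d := -d) hv.1 fun i hi => by simp [hd i hi])).and
    self_mem_nhdsWithin).exists
  have hε' : (0 : ℝ) < ε := hε
  have := hv.2 h1 h2 ⟨1 / 2, 1 / 2, by norm_num, by norm_num, by norm_num, by module⟩
  simpa [hε'.ne'] using this

variable [DecidableEq ι]

/-- `e` is dual to the normals of the inequalities active at `v`. -/
structure IsDual (ℓ : ι → V) (s : Finset ι) (e : ι → V) : Prop where
  inner_eq : ∀ i ∈ s, ∀ j ∈ s, ⟪e i, ℓ j⟫ = if i = j then 1 else 0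
  expand : ∀ u, ∑ i ∈ s, ⟪u, ℓ i⟫ • e i = u
  expand' : ∀ u, ∑ i ∈ s, ⟪u, e i⟫ • ℓ i = u

lemma exists_isDual [FiniteDimensional ℝ V] {v : V} (hv : v ∈ (poly ℓ h).extremePoints ℝ)
    (hc : (active ℓ h v).card = Module.finrank ℝ V) : ∃ e, IsDual ℓ (active ℓ h v) e := by
  set s := active ℓ h v with hs
  have hz : ∀ d, (∀ i ∈ s, ⟪d, ℓ i⟫ = 0) → d = 0 := fun d hd =>
    eq_zero_of_forall_inner_eq_zero hv fun i hi => by rw [real_inner_comm]; exact hd i hi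
  have hspan : ⊤ ≤ Submodule.span ℝ (Set.range fun i : s => ℓ i) := by
    rw [top_le_iff, ← Submodule.orthogonal_eq_bot_iff, Submodule.eq_bot_iff]
    intro d hd
    have hmem (i : s) : ℓ i ∈ Submodule.span ℝ (Set.range fun i : s => ℓ i) :=
      Submodule.subset_span ⟨i, rfl⟩
    exact hz d fun i hi => Submodule.inner_left_of_mem_orthogonal (hmem ⟨i, hi⟩) hd
  have hli : LinearIndependent ℝ fun i : s => ℓ i :=
    linearIndependent_of_top_le_span_of_card_eq_finrank hspan (by simpa using hc)
  let b := Module.Basis.mk hli hspan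
  let e : ι → V := fun i => if hi : i ∈ s then
    (InnerProductSpace.toDual ℝ V).symm (LinearMap.toContinuousLinearMap (b.coord ⟨i, hi⟩)) else 0
  have he : ∀ i (hi : i ∈ s) x, ⟪e i, x⟫ = b.repr x ⟨i, hi⟩ := by
    intro i hi x
    simp [e, hi]
  have h1 : ∀ i ∈ s, ∀ j ∈ s, ⟪e i, ℓ j⟫ = if i = j then 1 else 0 := by
    intro i hi j hj
    have hb : ℓ j = b ⟨j, hj⟩ := by simp [b]
    rw [he i hi, hb, b.repr_self, Finsupp.single_apply]
    simp [eq_comm]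
  refine ⟨e, h1, fun u => ?_, fun u => ?_⟩
  · rw [← sub_eq_zero]
    refine hz _ fun j hj => ?_
    rw [inner_sub_left, sum_inner, Finset.sum_eq_single_of_mem j hj]
    · rw [inner_smul_left, h1 j hj j hj]; simp
    · intro i hi hne
      rw [inner_smul_left, h1 i hi j hj, if_neg hne]; simp
  · rw [← Finset.sum_coe_sort]
    conv_rhs => rw [← b.sum_repr u]
    refine Finset.sum_congr rfl fun i _ => ?_
    rw [real_inner_comm, he i i.2]
    simp [b]

omit [DecidableEq ι] in
lemma exists_extreme_minimizer (hc : IsCompact (poly ℓ h)) (t : Finset ι) (y : V) {x₀ : V}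
    (hx₀ : x₀ ∈ poly ℓ h) (ht : t ⊆ active ℓ h x₀) :
    ∃ w ∈ (poly ℓ h).extremePoints ℝ, t ⊆ active ℓ h w ∧
      ∀ x ∈ poly ℓ h, t ⊆ active ℓ h x → ⟪y, w⟫ ≤ ⟪y, x⟫ := by
  set E : Set V := poly ℓ h ∩ {x | ∀ i ∈ t, ⟪ℓ i, x⟫ = h i} with hE
  have hact : ∀ x, t ⊆ active ℓ h x ↔ ∀ i ∈ t, ⟪ℓ i, x⟫ = h i := fun x =>
    forall₂_congr fun i _ => mem_active
  have hcl : IsClosed {x : V | ∀ i ∈ t, ⟪ℓ i, x⟫ = h i} := by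
    simp only [Set.ofPred_forall]
    exact isClosed_biInter fun i _ => isClosed_eq (by fun_prop) (by fun_prop)
  have hEc : IsCompact E := hc.inter_right hcl
  have hcont : Continuous fun x : V => ⟪y, x⟫ := by fun_prop
  obtain ⟨m, hm, hmin⟩ := hEc.exists_isMinOn ⟨x₀, hx₀, (hact _).1 ht⟩ hcont.continuousOn
  set M : Set V := E ∩ {x | ⟪y, x⟫ = ⟪y, m⟫} with hM
  have hMc : IsCompact M := hEc.inter_right (isClosed_eq hcont continuous_const)
  have hMext : IsExtreme ℝ (poly ℓ h) M := by
    refine ⟨fun x hx => hx.1.1, ?_⟩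
    rintro a ha b hb x ⟨⟨_, hx1⟩, hx2⟩ ⟨α, β, hα, hβ, hαβ, rfl⟩
    simp only [Set.mem_ofPred_eq, inner_add_right, inner_smul_right] at hx1 hx2
    have key : ∀ (p q r : ℝ), p ≤ r → q ≤ r → α * p + β * q = r → p = r ∧ q = r := by
      intro p q r hp hq hr
      have hβ' : β = 1 - α := by linarith
      subst hβ'
      constructor
      · nlinarith
      · nlinarith
    have haE : a ∈ E := ⟨ha, fun i hi => (key _ _ _ (ha i) (hb i) (hx1 i hi)).1⟩
    have hbE : b ∈ E := ⟨hb, fun i hi => (key _ _ _ (ha i) (hb i) (hx1 i hi)).2⟩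
    have h1 := hmin haE
    have h2 := hmin hbE
    simp only [Set.mem_ofPred_eq] at h1 h2
    refine ⟨haE, ?_⟩
    have := (key (-⟪y, a⟫) (-⟪y, b⟫) (-⟪y, m⟫) (by linarith) (by linarith) (by linarith)).1
    simp only [Set.mem_ofPred_eq]
    linarith
  obtain ⟨w, hw⟩ := hMc.extremePoints_nonempty ⟨m, hm, rfl⟩
  refine ⟨w, hMext.extremePoints_subset_extremePoints hw, (hact w).2 hw.1.1.2, fun x hx hxt => ?_⟩
  have h1 : ⟪y, w⟫ = ⟪y, m⟫ := hw.1.2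
  rw [h1]
  exact hmin ⟨hx, (hact x).1 hxt⟩

lemma exists_min_vertex (hc : IsCompact (poly ℓ h)) (t : Finset ι) (y : V) {e : V → ι → V}
    (he : ∀ v ∈ (poly ℓ h).extremePoints ℝ, IsDual ℓ (active ℓ h v) (e v)) {x₀ : V}
    (hx₀ : x₀ ∈ poly ℓ h) (ht : t ⊆ active ℓ h x₀) :
    ∃ w ∈ (poly ℓ h).extremePoints ℝ, t ⊆ active ℓ h w ∧
      ∀ i ∈ active ℓ h w, 0 < ⟪e w i, y⟫ → i ∈ t := by
  obtain ⟨w, hw, htw, hmin⟩ := exists_extreme_minimizer hc t y hx₀ ht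
  refine ⟨w, hw, htw, fun i hi hpos => ?_⟩
  by_contra hit
  have hin : ∀ j ∈ active ℓ h w, ⟪ℓ j, -e w i⟫ = -if i = j then 1 else 0 := by
    intro j hj
    rw [inner_neg_right, real_inner_comm, (he w hw).inner_eq i hi j hj]
  obtain ⟨ε, hε, hmem⟩ := exists_pos_mem_poly (d := -e w i) hw.1 fun j hj => by
    rw [hin j hj]; split_ifs <;> simp
  have := hmin _ hmem fun j hj => by
    have hne : i ≠ j := by rintro rfl; exact hit hj
    rw [mem_active, inner_add_right, inner_smul_right, hin j (htw hj), if_neg hne,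
      mem_active.1 (htw hj)]
    simp
  rw [inner_add_right, inner_smul_right, inner_neg_right, real_inner_comm (e w i) y] at this
  nlinarith

lemma eq_or_inner_lt {v w y : V} {e : ι → V} (he : IsDual ℓ (active ℓ h v) e)
    (hne : ∀ i ∈ active ℓ h v, ⟪e i, y⟫ ≠ 0) (hw : w ∈ poly ℓ h)
    (hd : ∀ i ∈ active ℓ h v, 0 < ⟪e i, y⟫ → i ∈ active ℓ h w) : v = w ∨ ⟪v, y⟫ < ⟪w, y⟫ := by
  have hsum := he.expand (w - v)
  have hcoef : ∀ i ∈ active ℓ h v, ⟪w - v, ℓ i⟫ ≤ 0 := fun i hi => by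
    rw [real_inner_comm, inner_sub_right, mem_active.1 hi]
    linarith [hw i]
  have hzero : ∀ i ∈ active ℓ h v, 0 < ⟪e i, y⟫ → ⟪w - v, ℓ i⟫ = 0 := fun i hi hp => by
    rw [real_inner_comm, inner_sub_right, mem_active.1 hi, mem_active.1 (hd i hi hp), sub_self]
  have hy : ⟪w, y⟫ - ⟪v, y⟫ = ∑ i ∈ active ℓ h v, ⟪w - v, ℓ i⟫ * ⟪e i, y⟫ := by
    rw [← inner_sub_left, ← hsum, sum_inner, hsum]
    simp [inner_smul_left]
  have hterm : ∀ i ∈ active ℓ h v, 0 ≤ ⟪w - v, ℓ i⟫ * ⟪e i, y⟫ := fun i hi => by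
    obtain hp | hp := lt_or_gt_of_ne (hne i hi)
    · exact mul_nonneg_of_nonpos_of_nonpos (hcoef i hi) hp.le
    · rw [hzero i hi hp, zero_mul]
  obtain h0 | h0 := (Finset.sum_nonneg hterm).eq_or_lt
  · left
    rw [eq_comm, ← sub_eq_zero, ← hsum]
    refine Finset.sum_eq_zero fun i hi => ?_
    have := (Finset.sum_eq_zero_iff_of_nonneg hterm).1 h0.symm i hi
    rw [(mul_eq_zero.1 this).resolve_right (hne i hi), zero_smul]
  · right
    linarith

/-- The volume of the parallelepiped spanned by the normals indexed by `s`. -/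
def vol [FiniteDimensional ℝ V] (ℓ : ι → V) (s : Finset ι) : ℝ :=
  if hs : s.card = Module.finrank ℝ V then
    |(Module.finBasis ℝ V).det fun k => ℓ ((s.equivFinOfCardEq hs).symm k)| else 0

omit [Fintype ι] [DecidableEq ι] in
lemma vol_eq [FiniteDimensional ℝ V] {s : Finset ι} (hs : s.card = Module.finrank ℝ V)
    {f : Fin (Module.finrank ℝ V) → ι} (hf : Function.Injective f) (hfs : ∀ k, f k ∈ s) :
    vol ℓ s = |(Module.finBasis ℝ V).det (ℓ ∘ f)| := by
  rw [vol, dif_pos hs]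
  set g := s.equivFinOfCardEq hs
  have hinj : Function.Injective fun k => g ⟨f k, hfs k⟩ := fun a b hab => hf (by simpa using hab)
  let σ : Equiv.Perm (Fin (Module.finrank ℝ V)) :=
    Equiv.ofBijective _ (Finite.injective_iff_bijective.1 hinj)
  have hcomp : ℓ ∘ f = (fun k => ℓ (g.symm k)) ∘ σ := by
    funext k
    simp [σ]
  rw [hcomp, AlternatingMap.map_perm]
  obtain h1 | h1 := Int.units_eq_one_or (Equiv.Perm.sign σ) <;> simp [h1]

omit [Fintype ι] in
lemma vol_ne_zero [FiniteDimensional ℝ V] {s : Finset ι} (hs : s.card = Module.finrank ℝ V)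
    {e : ι → V} (he : IsDual ℓ s e) : vol ℓ s ≠ 0 := by
  rw [vol, dif_pos hs, abs_ne_zero, ← isUnit_iff_ne_zero, ← Module.Basis.is_basis_iff_det]
  have hspan : ⊤ ≤ Submodule.span ℝ
      (Set.range fun k => ℓ ((s.equivFinOfCardEq hs).symm k)) := by
    intro u _
    rw [← he.expand' u]
    refine sum_mem fun i hi => Submodule.smul_mem _ _ (Submodule.subset_span ?_)
    exact ⟨s.equivFinOfCardEq hs ⟨i, hi⟩, by simp⟩
  exact ⟨linearIndependent_of_top_le_span_of_card_eq_finrank hspan (by simp),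
    top_le_iff.1 hspan⟩

omit [Fintype ι] in
lemma vol_insert [FiniteDimensional ℝ V] {t : Finset ι} {i j : ι} (hi : i ∉ t) (hj : j ∉ t)
    (ht : t.card + 1 = Module.finrank ℝ V) {e : ι → V} (he : IsDual ℓ (insert i t) e) :
    vol ℓ (insert j t) = |⟪e i, ℓ j⟫| * vol ℓ (insert i t) := by
  have hci : (insert i t).card = Module.finrank ℝ V := by rw [Finset.card_insert_of_notMem hi, ht]
  have hcj : (insert j t).card = Module.finrank ℝ V := by rw [Finset.card_insert_of_notMem hj, ht]
  set g := (insert i t).equivFinOfCardEq hci with hg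
  let f : Fin (Module.finrank ℝ V) → ι := fun k => g.symm k
  have hf : Function.Injective f := Subtype.val_injective.comp g.symm.injective
  have hfs : ∀ k, f k ∈ insert i t := fun k => (g.symm k).2
  have hsurj : ∀ l ∈ insert i t, ∃ k, f k = l := fun l hl => ⟨g ⟨l, hl⟩, by simp [f]⟩
  obtain ⟨k₀, hk₀⟩ := hsurj i (Finset.mem_insert_self i t)
  have hft : ∀ k, k ≠ k₀ → f k ∈ t := fun k hk =>
    (Finset.mem_insert.1 (hfs k)).resolve_left fun h => hk (hf (h.trans hk₀.symm))
  have hfj : Function.Injective (Function.update f k₀ j) := by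
    intro a b hab
    by_cases ha : a = k₀ <;> by_cases hb : b = k₀
    · rw [ha, hb]
    · rw [ha, Function.update_self, Function.update_of_ne hb] at hab
      exact absurd (hab ▸ hft b hb) hj
    · rw [hb, Function.update_self, Function.update_of_ne ha] at hab
      exact absurd (hab ▸ hft a ha) hj
    · rw [Function.update_of_ne ha, Function.update_of_ne hb] at hab
      exact hf hab
  rw [vol_eq hcj hfj, vol_eq hci hf hfs, Function.comp_update, ← abs_mul]
  swap
  · intro k
    by_cases hk : k = k₀
    · rw [hk, Function.update_self]; exact Finset.mem_insert_self j t
    · rw [Function.update_of_ne hk]; exact Finset.mem_insert_of_mem (hft k hk)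
  congr 1
  have hlin : ∀ x, (Module.finBasis ℝ V).det (Function.update (ℓ ∘ f) k₀ x) =
      (Module.finBasis ℝ V).det.toMultilinearMap.toLinearMap (ℓ ∘ f) k₀ x := fun x => rfl
  rw [hlin, ← he.expand' (ℓ j), map_sum,
    Finset.sum_eq_single_of_mem i (Finset.mem_insert_self i t), he.expand', map_smul, ← hlin]
  · rw [show ℓ i = (ℓ ∘ f) k₀ by simp [hk₀], Function.update_eq_self, real_inner_comm, smul_eq_mul]
  · intro l hl hne
    obtain ⟨k, rfl⟩ := hsurj l hl
    have hk : k₀ ≠ k := by rintro rfl; exact hne hk₀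
    rw [map_smul, ← hlin]
    erw [AlternatingMap.map_update_self _ _ hk]
    rw [smul_zero]

open Classical in
lemma edge_sum_eq_zero [FiniteDimensional ℝ V] (hc : IsCompact (poly ℓ h))
    (hcard : ∀ v ∈ (poly ℓ h).extremePoints ℝ, (active ℓ h v).card = Module.finrank ℝ V)
    {e : V → ι → V} (he : ∀ v ∈ (poly ℓ h).extremePoints ℝ, IsDual ℓ (active ℓ h v) (e v))
    [Fintype ((poly ℓ h).extremePoints ℝ)] {y : V}
    (hy : ∀ v ∈ (poly ℓ h).extremePoints ℝ, ∀ i ∈ active ℓ h v, ⟪e v i, y⟫ ≠ 0)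
    {t : Finset ι} (ht : t.card + 1 = Module.finrank ℝ V) :
    ∑ v : (poly ℓ h).extremePoints ℝ with t ⊆ active ℓ h v.1,
      (vol ℓ (active ℓ h v))⁻¹ * ∏ i ∈ active ℓ h v \ t, ⟪e v i, y⟫⁻¹ = 0 := by
  by_cases hv : ∃ v ∈ (poly ℓ h).extremePoints ℝ, t ⊆ active ℓ h v
  swap
  · refine Finset.sum_eq_zero fun v hv' => absurd ⟨v.1, v.2, ?_⟩ hv
    simpa using hv'
  have hother : ∀ v ∈ (poly ℓ h).extremePoints ℝ, t ⊆ active ℓ h v →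
      ∃ i, i ∉ t ∧ active ℓ h v = insert i t := by
    intro v hv htv
    have h1 : (active ℓ h v \ t).card = 1 := by
      rw [Finset.card_sdiff_of_subset htv, hcard v hv]; omega
    obtain ⟨i, hi⟩ := Finset.card_eq_one.1 h1
    have h2 : i ∈ active ℓ h v \ t := by rw [hi]; exact Finset.mem_singleton_self i
    refine ⟨i, (Finset.mem_sdiff.1 h2).2, ?_⟩
    rw [← Finset.sdiff_union_of_subset htv, hi]
    rfl
  obtain ⟨v, hv, htv⟩ := hv
  obtain ⟨i, hit, hvi⟩ := hother v hv htv
  have hev := hvi ▸ he v hv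
  have hii : i ∈ insert i t := Finset.mem_insert_self i t
  have hline : ∀ x, t ⊆ active ℓ h x → x - v = ⟪x - v, ℓ i⟫ • e v i := by
    intro x hx
    conv_lhs => rw [← hev.expand (x - v)]
    refine Finset.sum_eq_single_of_mem i hii fun j hj hne => ?_
    have hjt : j ∈ t := (Finset.mem_insert.1 hj).resolve_left hne
    rw [real_inner_comm, inner_sub_right, mem_active.1 (hx hjt), mem_active.1 (htv hjt), sub_self,
      zero_smul]
  have hvh : ⟪ℓ i, v⟫ = h i := mem_active.1 (hvi ▸ hii)
  obtain ⟨w, hw, htw, hmin⟩ := exists_extreme_minimizer hc t (ℓ i) hv.1 htv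
  have hin : ∀ j ∈ active ℓ h v, ⟪ℓ j, -e v i⟫ = -if i = j then 1 else 0 := by
    intro j hj
    rw [inner_neg_right, real_inner_comm, hev.inner_eq i hii j (hvi ▸ hj)]
  have hwlt : ⟪w - v, ℓ i⟫ < 0 := by
    obtain ⟨ε, hε, hmem⟩ := exists_pos_mem_poly (d := -e v i) hv.1 fun j hj => by
      rw [hin j hj]; split_ifs <;> simp
    have := hmin _ hmem fun j hj => by
      have hne : i ≠ j := by rintro rfl; exact hit hj
      rw [mem_active, inner_add_right, inner_smul_right, hin j (htv hj), if_neg hne,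
        mem_active.1 (htv hj)]
      simp
    rw [inner_add_right, inner_smul_right, hin i (hvi ▸ hii), if_pos rfl] at this
    rw [real_inner_comm, inner_sub_right]
    linarith
  have hwv : w ≠ v := by
    rintro rfl
    simp at hwlt
  obtain ⟨j, hjt, hwj⟩ := hother w hw htw
  have hew := hwj ▸ he w hw
  have hjj : j ∈ insert j t := Finset.mem_insert_self j t
  have hwh : ⟪ℓ j, w⟫ = h j := mem_active.1 (hwj ▸ hjj)
  have hjv : j ∉ active ℓ h v := by
    intro hj
    rw [hvi] at hj
    obtain rfl := (Finset.mem_insert.1 hj).resolve_right hjt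
    rw [real_inner_comm, inner_sub_right, hvh, hwh, sub_self] at hwlt
    exact lt_irrefl _ hwlt
  set s := ⟪e v i, ℓ j⟫ with hs
  have hsneg : s < 0 := by
    have h1 : 0 < ⟪w - v, ℓ j⟫ := by
      rw [real_inner_comm, inner_sub_right, hwh, sub_pos]
      exact lt_of_le_of_ne (hv.1 j) fun h => hjv (mem_active.2 h)
    rw [hline w htw, inner_smul_left] at h1
    have h2 : 0 < ⟪w - v, ℓ i⟫ * s := h1
    nlinarith
  have heq : e v i = s • e w j := by
    conv_lhs => rw [← hew.expand (e v i)]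
    refine Finset.sum_eq_single_of_mem j hjj fun k hk hne => ?_
    have hkt : k ∈ t := (Finset.mem_insert.1 hk).resolve_left hne
    rw [hev.inner_eq i hii k (Finset.mem_insert_of_mem hkt), if_neg, zero_smul]
    rintro rfl
    exact hit hkt
  have hset : (Finset.univ.filter fun x : (poly ℓ h).extremePoints ℝ => t ⊆ active ℓ h x.1) =
      {⟨v, hv⟩, ⟨w, hw⟩} := by
    ext ⟨x, hx⟩
    simp only [Finset.mem_filter, Finset.mem_univ, true_and, Finset.mem_insert,
      Finset.mem_singleton, Subtype.mk.injEq]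
    refine ⟨fun htx => ?_, ?_⟩
    swap
    · rintro (rfl | rfl)
      · exact htv
      · exact htw
    have hx1 : ⟪x - v, ℓ i⟫ ≤ 0 := by
      rw [real_inner_comm, inner_sub_right, hvh]
      linarith [hx.1 i]
    have hx2 : ⟪w - v, ℓ i⟫ ≤ ⟪x - v, ℓ i⟫ := by
      rw [inner_sub_left, inner_sub_left, real_inner_comm _ w, real_inner_comm _ x]
      linarith [hmin x hx.1 htx]
    set a := ⟪x - v, ℓ i⟫ with ha
    set b := ⟪w - v, ℓ i⟫ with hb
    have hxa := hline x htx
    have hwb := hline w htw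
    by_contra! hne
    have ha0 : a < 0 := lt_of_le_of_ne hx1 fun h0 => hne.1 (by
      rw [← ha, h0, zero_smul, sub_eq_zero] at hxa; exact hxa)
    have hab : b < a := lt_of_le_of_ne hx2 fun h0 => hne.2 (by
      rw [← ha, ← h0, hb, ← hwb] at hxa; exact sub_left_injective hxa)
    refine hne.1 (hx.2 hv.1 hw.1 ⟨1 - a / b, a / b, ?_, ?_, by ring, ?_⟩).symm
    · rw [sub_pos, div_lt_one_of_neg hwlt]; exact hab
    · exact div_pos_of_neg_of_neg ha0 hwlt
    · have h1 : x = v + a • e v i := by rw [← hxa]; abel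
      have h2 : w = v + b • e v i := by rw [← hwb]; abel
      rw [h2, h1, smul_add, smul_smul, div_mul_cancel₀ _ hwlt.ne, ← add_assoc, ← add_smul]
      simp
  have hne : (⟨v, hv⟩ : (poly ℓ h).extremePoints ℝ) ≠ ⟨w, hw⟩ := fun h => hwv
    (congrArg Subtype.val h).symm
  have hsd : ∀ k, k ∉ t → insert k t \ t = {k} := fun k hk => by
    rw [Finset.insert_sdiff_of_notMem _ hk, Finset.sdiff_self]
    rfl
  rw [hset, Finset.sum_pair hne]
  have hyj := hy w hw j (hwj ▸ hjj)
  have hvol : vol ℓ (insert i t) ≠ 0 := vol_ne_zero (hvi ▸ hcard v hv) hev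
  simp only [hvi, hwj]
  rw [hsd i hit, hsd j hjt, Finset.prod_singleton, Finset.prod_singleton,
    vol_insert hit hjt ht hev, ← hs, abs_of_neg hsneg, heq, inner_smul_left]
  simp only [conj_trivial]
  field_simp
  ring

lemma exists_generic [FiniteDimensional ℝ V] {κ : Type*} [Finite κ] (x : κ → V)
    (hx : ∀ k, x k ≠ 0) : ∃ y : V, ∀ k, ⟪x k, y⟫ ≠ 0 := by
  obtain ⟨f, hf⟩   := Module.exists_dual_forall_apply_ne_zero (K := ℝ) x hx
  exact ⟨(InnerProductSpace.toDual ℝ V).symm (LinearMap.toContinuousLinearMap f), fun k => by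
    rw [real_inner_comm]; simpa using hf k⟩

end HPolytope

/-- Combinatorial and numerical data of a simple polytope with vertex set `κ` and facet set `ι`,
together with a generic linear functional: `inc v` is the set of facets through `v`, `coeff u F` is
the pairing of `u` with the normal of `F`, `e v` is the basis dual to the normals at `v`, `θ` is the
functional, `wt v F = θ (e v F)`, and `c v` is the weight of `v` in the localization formula. -/
structure SimpleFan (ι κ U : Type*) [Fintype ι] [DecidableEq ι] [Fintype κ] where
  n : ℕ
  inc : κ → Finset ι
  coeff : U → ι → ℝ
  e : κ → ι → U
  wt : κ → ι → ℝ
  θ : U → ℝ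
  c : κ → ℝ
  height : κ → ℝ
  vertex : κ
  card_inc : ∀ v, (inc v).card = n
  coeff_e : ∀ v, ∀ F ∈ inc v, ∀ G ∈ inc v, coeff (e v F) G = if F = G then 1 else 0
  expand : ∀ v u, ∑ F ∈ inc v, coeff u F * wt v F = θ u
  wt_ne_zero : ∀ v, ∀ F ∈ inc v, wt v F ≠ 0
  c_ne_zero : ∀ v, c v ≠ 0
  exists_min : ∀ (t : Finset ι) v, t ⊆ inc v →
    ∃ w, t ⊆ inc w ∧ ∀ F ∈ inc w, 0 < wt w F → F ∈ t
  lower : ∀ v w, (∀ F ∈ inc v, 0 < wt v F → F ∈ inc w) → v = w ∨ height v < height w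
  upper : ∀ v w, (∀ F ∈ inc v, wt v F < 0 → F ∈ inc w) → v = w ∨ height w < height v
  edge : ∀ t : Finset ι, t.card + 1 = n →
    ∑ v with t ⊆ inc v, c v * ∏ F ∈ inc v \ t, (wt v F)⁻¹ = 0

namespace SimpleFan

open MvPolynomial

lemma monomial_eq_prod_X {ι : Type*} {s : ι →₀ ℕ} (h : ∀ F, s F ≤ 1) :
    monomial s (1 : ℝ) = ∏ F ∈ s.support, X F := by
  rw [monomial_eq, Finsupp.prod, C_1, one_mul]
  refine Finset.prod_congr rfl fun F hF => ?_
  have h1 := h F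
  have h2 : s F ≠ 0 := by simpa using hF
  rw [show s F = 1 by omega, pow_one]

lemma card_support_le_degree {ι : Type*} (s : ι →₀ ℕ) : s.support.card ≤ s.degree := by
  rw [Finsupp.degree, Finset.card_eq_sum_ones]
  exact Finset.sum_le_sum fun F hF => Nat.one_le_iff_ne_zero.2 (by simpa using hF)

lemma exists_eq_add_single {ι : Type*} {s : ι →₀ ℕ} {F : ι} (h : s F ≠ 0) :
    ∃ s', s = s' + Finsupp.single F 1 :=
  ⟨s - Finsupp.single F 1, (tsub_add_cancel_of_le (by
    rw [Finsupp.single_le_iff]; omega)).symm⟩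

variable {ι κ U : Type*} [Fintype ι] [DecidableEq ι] [Fintype κ] (D : SimpleFan ι κ U)

/-- The linear relation attached to `u`. -/
def rel (u : U) : MvPolynomial ι ℝ := ∑ F, C (D.coeff u F) * X F

/-- The ideal generated by the non-face monomials and the linear relations. -/
def ideal : Ideal (MvPolynomial ι ℝ) :=
  Ideal.span {p | ∃ t : Finset ι, (∀ v, ¬ t ⊆ D.inc v) ∧ p = ∏ F ∈ t, X F} +
    Ideal.span {p | ∃ u, p = D.rel u}

lemma theta_e (v : κ) {F : ι} (hF : F ∈ D.inc v) : D.θ (D.e v F) = D.wt v F := by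
  rw [← D.expand v]
  rw [Finset.sum_eq_single_of_mem F hF]
  · rw [D.coeff_e v F hF F hF]; simp
  · intro G hG hne
    rw [D.coeff_e v F hF G hG, if_neg hne.symm, zero_mul]

/-- The point at which polynomials are evaluated by localization at `v`. -/
def loc (v : κ) (F : ι) : ℝ := if F ∈ D.inc v then D.wt v F else 0

/-- The localization formula for integration. -/
def integ : MvPolynomial ι ℝ →ₗ[ℝ] ℝ :=
  ∑ v, (D.c v * ∏ F ∈ D.inc v, (D.wt v F)⁻¹) • (aeval (D.loc v)).toLinearMap

lemma integ_apply (p : MvPolynomial ι ℝ) :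
    D.integ p = ∑ v, (D.c v * ∏ F ∈ D.inc v, (D.wt v F)⁻¹) * aeval (D.loc v) p := by
  simp [integ]

lemma aeval_rel (v : κ) (u : U) : aeval (D.loc v) (D.rel u) = D.θ u := by
  rw [← D.expand v, rel, map_sum]
  simp [loc, Finset.sum_ite_mem]

lemma integ_rel_mul (u : U) (p : MvPolynomial ι ℝ) : D.integ (D.rel u * p) = D.θ u * D.integ p := by
  simp only [integ_apply, map_mul, aeval_rel, Finset.mul_sum]
  exact Finset.sum_congr rfl fun v _ => by ring

lemma aeval_prod_eq_zero {v : κ} {t : Finset ι} (h : ¬ t ⊆ D.inc v) :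
    aeval (D.loc v) (∏ F ∈ t, X F : MvPolynomial ι ℝ) = 0 := by
  obtain ⟨F, hF, hv⟩ := Finset.not_subset.1 h
  rw [map_prod]
  exact Finset.prod_eq_zero hF (by simp [loc, hv])

lemma integ_prod (t : Finset ι) : D.integ (∏ F ∈ t, X F) =
    ∑ v with t ⊆ D.inc v, D.c v * ∏ F ∈ D.inc v \ t, (D.wt v F)⁻¹ := by
  rw [integ_apply, Finset.sum_filter]
  refine Finset.sum_congr rfl fun v _ => ?_
  split_ifs with h
  · have h1 : aeval (D.loc v) (∏ F ∈ t, X F : MvPolynomial ι ℝ) = ∏ F ∈ t, D.wt v F := by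
      rw [map_prod]
      exact Finset.prod_congr rfl fun F hF => by simp [loc, h hF]
    rw [h1, ← Finset.prod_sdiff h, mul_assoc, mul_assoc, ← Finset.prod_mul_distrib,
      Finset.prod_congr rfl fun F hF => inv_mul_cancel₀ (D.wt_ne_zero v F (h hF))]
    simp
  · rw [D.aeval_prod_eq_zero h, mul_zero]

lemma integ_prod_inc (v : κ) : D.integ (∏ F ∈ D.inc v, X F) = D.c v := by
  rw [integ_prod, Finset.sum_eq_single_of_mem v (by simp)]
  · simp
  · intro w hw hne
    have hw' : D.inc v ⊆ D.inc w := by simpa using hw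
    have h1 := D.lower v w fun F hF _ => hw' hF
    have h2 := D.upper v w fun F hF _ => hw' hF
    have := hne.symm
    exact absurd (h1.resolve_left this) (h2.resolve_left this).not_gt

lemma integ_squarefree (t : Finset ι) (ht : t.card < D.n) : D.integ (∏ F ∈ t, X F) = 0 := by
  induction hk : D.n - t.card using Nat.strong_induction_on generalizing t with
  | _ k ih =>
    by_cases he : t.card + 1 = D.n
    · rw [integ_prod, D.edge t he]
    by_cases hv : ∃ v, t ⊆ D.inc v
    swap
    · rw [integ_prod, Finset.sum_eq_zero]
      intro v hv'
      exact absurd ⟨v, by simpa using hv'⟩ hv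
    obtain ⟨v, hv⟩ := hv
    obtain ⟨F₀, hF₀, hF₀t⟩ := Finset.exists_mem_notMem_of_card_lt_card
      (show t.card < (D.inc v).card by rwa [D.card_inc])
    have key : D.θ (D.e v F₀) * D.integ (∏ F ∈ t, X F) = 0 := by
      rw [← integ_rel_mul, rel, Finset.sum_mul, map_sum]
      refine Finset.sum_eq_zero fun F _ => ?_
      by_cases hF : F ∈ t
      · rw [D.coeff_e v F₀ hF₀ F (hv hF), if_neg (by rintro rfl; exact hF₀t hF)]
        simp
      · rw [mul_assoc, ← Finset.prod_insert hF, C_mul', map_smul,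
          ih _ _ (insert F t) _ rfl, smul_zero]
        · rw [Finset.card_insert_of_notMem hF]; omega
        · rw [Finset.card_insert_of_notMem hF]; omega
    rw [D.theta_e v hF₀] at key
    exact (mul_eq_zero.1 key).resolve_left (D.wt_ne_zero v F₀ hF₀)

lemma aeval_monomial_eq_zero {v : κ} {s : ι →₀ ℕ} (h : ¬ s.support ⊆ D.inc v) :
    aeval (D.loc v) (monomial s (1 : ℝ)) = 0 := by
  obtain ⟨F, hF, hv⟩ := Finset.not_subset.1 h
  rw [aeval_monomial, Finsupp.prod, Finset.prod_eq_zero hF, mul_zero]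
  simpa [loc, hv] using hF

lemma rel_mul_monomial (u : U) (s : ι →₀ ℕ) : D.rel u * monomial s 1 =
    ∑ F, D.coeff u F • monomial (s + Finsupp.single F 1) (1 : ℝ) := by
  rw [rel, Finset.sum_mul]
  refine Finset.sum_congr rfl fun F _ => ?_
  rw [mul_assoc, C_mul', X, monomial_mul, add_comm, one_mul]

lemma integ_monomial (s : ι →₀ ℕ) (hs : s.degree < D.n) : D.integ (monomial s 1) = 0 := by
  induction hk : 2 * s.degree - s.support.card using Nat.strong_induction_on generalizing s with
  | _ k ih =>
    by_cases hsq : ∀ F, s F ≤ 1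
    · rw [monomial_eq_prod_X hsq]
      exact D.integ_squarefree _ ((card_support_le_degree s).trans_lt hs)
    push Not at hsq
    obtain ⟨F₀, hF₀⟩ := hsq
    by_cases hv : ∃ v, s.support ⊆ D.inc v
    swap
    · rw [integ_apply]
      refine Finset.sum_eq_zero fun v _ => ?_
      rw [D.aeval_monomial_eq_zero fun h => hv ⟨v, h⟩, mul_zero]
    obtain ⟨v, hv⟩ := hv
    obtain ⟨s', rfl⟩ := exists_eq_add_single (s := s) (F := F₀) (by omega)
    have hF₀' : F₀ ∈ s'.support := by
      simp at hF₀ ⊢; omega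
    have hsupp : ∀ F, (s' + Finsupp.single F 1).support = insert F s'.support := by
      intro F
      ext G
      by_cases h : F = G <;> simp [h, eq_comm]
    have hdeg : ∀ F, (s' + Finsupp.single F 1).degree = s'.degree + 1 := by
      intro F
      simp [map_add]
    have hle := card_support_le_degree s'
    rw [hsupp, Finset.insert_eq_of_mem hF₀'] at hv hk
    rw [hdeg] at hs hk
    have h0 := D.integ_rel_mul (D.e v F₀) (monomial s' 1)
    rw [ih _ _ s' (by omega) rfl, mul_zero, rel_mul_monomial, map_sum,
      Finset.sum_eq_single_of_mem F₀ (Finset.mem_univ _)] at h0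
    · rwa [D.coeff_e v F₀ (hv hF₀') F₀ (hv hF₀'), if_pos rfl, one_smul] at h0
    · intro F _ hne
      by_cases hF : F ∈ s'.support
      · rw [D.coeff_e v F₀ (hv hF₀') F (hv hF), if_neg hne.symm, zero_smul, map_zero]
      · rw [map_smul, ih _ _ (s' + Finsupp.single F 1) _ rfl, smul_zero]
        · rw [hsupp, hdeg, Finset.card_insert_of_notMem hF]; omega
        · rw [hdeg]; omega
    · omega

/-- The integral of the component of top degree. -/
def topInteg : MvPolynomial ι ℝ →ₗ[ℝ] ℝ := D.integ ∘ₗ homogeneousComponent D.n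

lemma topInteg_of_isHomogeneous {p : MvPolynomial ι ℝ} {k : ℕ} (hp : p.IsHomogeneous k) :
    D.topInteg p = if k = D.n then D.integ p else 0 := by
  rw [topInteg, LinearMap.comp_apply, homogeneousComponent_of_mem hp]
  split_ifs with h1 h2 h3
  · rfl
  · exact absurd h1.symm h2
  · exact absurd h3.symm h1
  · simp

lemma rel_isHomogeneous (u : U) : (D.rel u).IsHomogeneous 1 :=
  IsHomogeneous.sum _ _ _ fun F _ => by
    simpa using (isHomogeneous_C ι (D.coeff u F)).mul (isHomogeneous_X ℝ F)

lemma topInteg_mul_eq_zero {p : MvPolynomial ι ℝ}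
    (h : ∀ s : ι →₀ ℕ, D.topInteg (monomial s 1 * p) = 0) (q : MvPolynomial ι ℝ) :
    D.topInteg (q * p) = 0 := by
  induction q using MvPolynomial.induction_on' with
  | monomial s a =>
    rw [show monomial s a = a • monomial s (1 : ℝ) by simp [smul_monomial], smul_mul_assoc,
      map_smul, h, smul_zero]
  | add a b ha hb => rw [add_mul, map_add, ha, hb, add_zero]

lemma topInteg_eq_zero {p : MvPolynomial ι ℝ} (hp : p ∈ D.ideal) : D.topInteg p = 0 := by
  rw [ideal, Submodule.add_eq_sup, ← Ideal.span_union] at hp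
  suffices h : ∀ q, D.topInteg (q * p) = 0 by simpa using h 1
  induction hp using Submodule.span_induction with
  | zero => simp
  | add a b _ _ ha hb => intro q; rw [mul_add, map_add, ha, hb, add_zero]
  | smul a b _ hb => intro q; rw [smul_eq_mul, ← mul_assoc, hb]
  | mem p hp =>
    refine D.topInteg_mul_eq_zero fun s => ?_
    obtain ⟨t, ht, rfl⟩ | ⟨u, rfl⟩ := hp
    · rw [D.topInteg_of_isHomogeneous ((isHomogeneous_monomial (1 : ℝ) rfl).mul
        (IsHomogeneous.prod t _ (fun _ => 1) fun F _ => isHomogeneous_X ℝ F))]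
      have : D.integ (monomial s 1 * ∏ F ∈ t, X F) = 0 := by
        rw [integ_apply]
        refine Finset.sum_eq_zero fun v _ => ?_
        rw [map_mul, D.aeval_prod_eq_zero (ht v), mul_zero, mul_zero]
      rw [this, ite_self]
    · rw [D.topInteg_of_isHomogeneous ((isHomogeneous_monomial (1 : ℝ) rfl).mul
        (D.rel_isHomogeneous u)), mul_comm, integ_rel_mul]
      split_ifs with h
      · rw [D.integ_monomial s (by omega), mul_zero]
      · rfl

/-- The facets through `v` whose opposite edge at `v` is descending. -/
def down (v : κ) : Finset ι := {F ∈ D.inc v | 0 < D.wt v F}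

/-- The facets through `v` whose opposite edge at `v` is ascending. -/
def up (v : κ) : Finset ι := {F ∈ D.inc v | D.wt v F < 0}

lemma prod_down_mul_prod_up (v : κ) :
    (∏ F ∈ D.down v, X F) * ∏ F ∈ D.up v, X F = (∏ F ∈ D.inc v, X F : MvPolynomial ι ℝ) := by
  rw [← Finset.prod_filter_mul_prod_filter_not (D.inc v) (fun F => 0 < D.wt v F), down, up]
  congr 2
  refine Finset.filter_congr fun F hF => ?_
  have := D.wt_ne_zero v F hF
  rw [not_lt]
  exact ⟨le_of_lt, fun h => lt_of_le_of_ne h this⟩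

lemma card_down_add_card_up (v : κ) : (D.down v).card + (D.up v).card = D.n := by
  rw [← D.card_inc v, ← Finset.card_filter_add_card_filter_not (s := D.inc v)
    (fun F => 0 < D.wt v F), down, up]
  congr 2
  refine Finset.filter_congr fun F hF => ?_
  have := D.wt_ne_zero v F hF
  rw [not_lt]
  exact ⟨le_of_lt, fun h => lt_of_le_of_ne h this⟩

lemma prod_X_mem_ideal {t : Finset ι} (h : ∀ v, ¬ t ⊆ D.inc v) : ∏ F ∈ t, X F ∈ D.ideal :=
  Ideal.mem_sup_left (Ideal.subset_span ⟨t, h, rfl⟩)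

lemma rel_mem_ideal (u : U) : D.rel u ∈ D.ideal :=
  Ideal.mem_sup_right (Ideal.subset_span ⟨u, rfl⟩)

lemma monomial_mem_ideal {s : ι →₀ ℕ} (h : ∀ v, ¬ s.support ⊆ D.inc v) :
    monomial s 1 ∈ D.ideal := by
  refine Ideal.mem_of_dvd _ ?_ (D.prod_X_mem_ideal h)
  rw [monomial_eq, C_1, one_mul, Finsupp.prod]
  exact Finset.prod_dvd_prod_of_dvd _ _ fun F hF => dvd_pow_self _ (by simpa using hF)

/-- The quotient map. -/
abbrev cls : MvPolynomial ι ℝ →ₐ[ℝ] MvPolynomial ι ℝ ⧸ D.ideal := Ideal.Quotient.mkₐ ℝ D.ideal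

lemma cls_eq_zero {p : MvPolynomial ι ℝ} : D.cls p = 0 ↔ p ∈ D.ideal := by
  simp [cls, Ideal.Quotient.mkₐ_eq_mk, Ideal.Quotient.eq_zero_iff_mem]

/-- The span of the classes of the descending monomials of degree `i`. -/
def downSpan (i : ℕ) : Submodule ℝ (MvPolynomial ι ℝ ⧸ D.ideal) :=
  Submodule.span ℝ ((fun v => D.cls (∏ F ∈ D.down v, X F)) '' {v | (D.down v).card = i})

lemma cls_monomial_mem_downSpan_of_vertex (v : κ) (s : ι →₀ ℕ) (h1 : D.down v ⊆ s.support)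
    (h2 : s.support ⊆ D.inc v) : D.cls (monomial s 1) ∈ D.downSpan s.degree := by
  induction hm : (Finset.univ.filter fun w => D.height v < D.height w).card
    using Nat.strong_induction_on generalizing v s with
  | _ m ih =>
    have step : ∀ s' : ι →₀ ℕ, D.down v ⊆ s'.support → ¬ s'.support ⊆ D.inc v →
        D.cls (monomial s' 1) ∈ D.downSpan s'.degree := by
      intro s' hs1 hs2
      by_cases hw : ∃ w, s'.support ⊆ D.inc w
      swap
      · rw [D.cls_eq_zero.2 (D.monomial_mem_ideal fun w h => hw ⟨w, h⟩)]
        exact zero_mem _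
      obtain ⟨w', hw'⟩ := hw
      obtain ⟨w, hw1, hw2⟩ := D.exists_min _ _ hw'
      have hlt : D.height v < D.height w := by
        refine (D.lower v w fun F hF hp => hw1 (hs1 ?_)).resolve_left ?_
        · simp [down, hF, hp]
        · rintro rfl
          exact hs2 hw1
      refine ih _ ?_ w s' (fun F hF => ?_) hw1 rfl
      · rw [← hm]
        refine Finset.card_lt_card ⟨fun x hx => ?_, fun h => ?_⟩
        · simp at hx ⊢
          exact hlt.trans hx
        · have := h (show w ∈ _ by simpa using hlt)
          simp at this
      · simp [down] at hF
        exact hw2 F hF.1 hF.2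
    by_cases hsq : ∃ F₀ ∈ s.support, D.down v ⊆ (s - Finsupp.single F₀ 1).support
    · obtain ⟨F₀, hF₀, hd⟩ := hsq
      obtain ⟨s', rfl⟩ := exists_eq_add_single (s := s) (F := F₀) (by simpa using hF₀)
      rw [add_tsub_cancel_right] at hd
      have hdeg : ∀ F, (s' + Finsupp.single F 1).degree = s'.degree + 1 := by
        intro F
        simp [map_add]
      have hrel : D.cls (D.rel (D.e v F₀) * monomial s' 1) = 0 :=
        D.cls_eq_zero.2 (Ideal.mul_mem_right _ _ (D.rel_mem_ideal _))
      rw [rel_mul_monomial, map_sum, ← Finset.add_sum_erase _ _ (Finset.mem_univ F₀),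
        D.coeff_e v F₀ (h2 hF₀) F₀ (h2 hF₀), if_pos rfl, one_smul] at hrel
      rw [eq_neg_of_add_eq_zero_left hrel]
      refine neg_mem (sum_mem fun F hF => ?_)
      have hne : F ≠ F₀ := Finset.ne_of_mem_erase hF
      by_cases hFv : F ∈ D.inc v
      · rw [D.coeff_e v F₀ (h2 hF₀) F hFv, if_neg hne.symm, zero_smul, map_zero]
        exact zero_mem _
      · rw [map_smul, hdeg F₀, ← hdeg F]
        refine Submodule.smul_mem _ _ (step _ (fun G hG => ?_) fun h => hFv (h ?_))
        · have := hd hG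
          simp at this ⊢
          exact fun h => absurd h this
        · simp
    · push Not at hsq
      have hle : ∀ F, s F ≤ 1 := by
        intro F
        by_contra hF
        refine hsq F (by simp; omega) fun G hG => ?_
        have := h1 hG
        simp [Finsupp.single_apply] at this ⊢
        split_ifs with h
        · subst h; omega
        · omega
      have hsupp : s.support = D.down v := by
        refine Finset.Subset.antisymm (fun F hF => ?_) h1
        by_contra hFd
        refine hsq F hF fun G hG => ?_
        have := h1 hG
        have hne : F ≠ G := by rintro rfl; exact hFd hG
        simpa [Finsupp.single_apply, hne] using this
      have hcard : s.degree = (D.down v).card := by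
        rw [← hsupp, Finsupp.degree, Finset.card_eq_sum_ones]
        refine Finset.sum_congr rfl fun F hF => ?_
        have := hle F
        have : s F ≠ 0 := by simpa using hF
        omega
      rw [monomial_eq_prod_X hle, hsupp]
      exact Submodule.subset_span ⟨v, hcard.symm, rfl⟩

lemma cls_monomial_mem_downSpan (s : ι →₀ ℕ) : D.cls (monomial s 1) ∈ D.downSpan s.degree := by
  by_cases hw : ∃ w, s.support ⊆ D.inc w
  · obtain ⟨w', hw'⟩ := hw
    obtain ⟨w, hw1, hw2⟩ := D.exists_min _ _ hw'
    refine D.cls_monomial_mem_downSpan_of_vertex w s (fun F hF => ?_) hw1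
    simp [down] at hF
    exact hw2 F hF.1 hF.2
  · rw [D.cls_eq_zero.2 (D.monomial_mem_ideal fun w h => hw ⟨w, h⟩)]
    exact zero_mem _

/-- The piece of degree `i` of the quotient by the ideal. -/
def piece (i : ℕ) : Submodule ℝ (MvPolynomial ι ℝ ⧸ D.ideal) :=
  (homogeneousSubmodule ι ℝ i).map D.cls.toLinearMap

lemma cls_prod_mem_piece (t : Finset ι) : D.cls (∏ F ∈ t, X F) ∈ D.piece t.card := by
  refine Submodule.mem_map_of_mem ?_
  simpa using IsHomogeneous.prod t _ (fun _ => 1) fun F _ => isHomogeneous_X ℝ F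

lemma piece_eq_downSpan (i : ℕ) : D.piece i = D.downSpan i := by
  refine le_antisymm ?_ (Submodule.span_le.2 ?_)
  · rw [piece, Submodule.map_le_iff_le_comap]
    intro p hp
    have hp' : p.IsHomogeneous i := hp
    rw [Submodule.mem_comap, p.as_sum, map_sum]
    refine sum_mem fun s hs => ?_
    have hd : s.degree = i := by
      have := hp' (by simpa using hs)
      rwa [Finsupp.degree_eq_weight_one]
    rw [show monomial s (p.coeff s) = p.coeff s • monomial s (1 : ℝ) by simp [smul_monomial],
      map_smul, ← hd]
    exact Submodule.smul_mem _ _ (D.cls_monomial_mem_downSpan s)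
  · rintro _ ⟨v, rfl, rfl⟩
    exact D.cls_prod_mem_piece _

lemma cls_prod_inc_ne_zero (v : κ) : D.cls (∏ F ∈ D.inc v, X F) ≠ 0 := by
  intro h
  have h1 := D.topInteg_eq_zero (D.cls_eq_zero.1 h)
  rw [D.topInteg_of_isHomogeneous (IsHomogeneous.prod (D.inc v) _ (fun _ => 1)
    fun F _ => isHomogeneous_X ℝ F), if_pos (by simp [D.card_inc]), integ_prod_inc] at h1
  exact D.c_ne_zero v h1

lemma piece_eq_bot {i : ℕ} (hi : D.n < i) : D.piece i = ⊥ := by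
  rw [piece_eq_downSpan, downSpan, Submodule.span_eq_bot]
  rintro _ ⟨v, hv, rfl⟩
  have := D.card_down_add_card_up v
  have hv' : (D.down v).card = i := hv
  omega

lemma finrank_piece_top : Module.finrank ℝ (D.piece D.n) = 1 := by
  have hne : D.piece D.n ≠ ⊥ := by
    intro h
    have h1 := D.cls_prod_mem_piece (D.inc D.vertex)
    rw [D.card_inc, h, Submodule.mem_bot] at h1
    exact D.cls_prod_inc_ne_zero _ h1
  have hex : ∃ v, (D.down v).card = D.n := by
    by_contra! hcon
    refine hne ?_
    rw [piece_eq_downSpan, downSpan, Submodule.span_eq_bot]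
    rintro _ ⟨v, hv, rfl⟩
    exact absurd hv (hcon v)
  obtain ⟨v, hv⟩ := hex
  have hmax : ∀ v, (D.down v).card = D.n → ∀ w, v = w ∨ D.height w < D.height v := by
    intro v hv w
    refine D.upper v w fun F hF hn => ?_
    have h1 : F ∈ D.up v := by simp [up, hF, hn]
    have h2 := D.card_down_add_card_up v
    have h3 := Finset.card_pos.2 ⟨F, h1⟩
    omega
  have huniq : {w | (D.down w).card = D.n} = {v} := by
    ext w
    simp only [Set.mem_ofPred_eq, Set.mem_singleton_iff]
    refine ⟨fun hw => ?_, fun h => h ▸ hv⟩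
    obtain h | h := hmax v hv w
    · exact h.symm
    obtain h' | h' := hmax w hw v
    · exact h'
    · exact absurd h h'.not_gt
  rw [piece_eq_downSpan, downSpan, huniq, Set.image_singleton] at hne ⊢
  exact finrank_span_singleton fun h => hne (by rw [h, Submodule.span_singleton_eq_bot])

lemma cls_down_mul_cls_up_eq_zero {v w : κ} (hne : v ≠ w) (h : D.height w ≤ D.height v) :
    D.cls (∏ F ∈ D.down v, X F) * D.cls (∏ F ∈ D.up w, X F) = 0 := by
  rw [← map_mul, cls_eq_zero]
  refine Ideal.mem_of_dvd _ ?_ (D.prod_X_mem_ideal (t := D.down v ∪ D.up w) fun x hx => ?_)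
  · rw [← Finset.prod_union_inter]
    exact dvd_mul_right _ _
  · have h1 := D.lower v x fun F hF hp => hx (by simp [down, hF, hp])
    have h2 := D.upper w x fun F hF hp => hx (by simp [up, hF, hp])
    obtain rfl | h1 := h1
    · exact hne (h2.resolve_right h.not_gt).symm
    · obtain rfl | h2 := h2
      · exact absurd h1 h.not_gt
      · exact absurd (h1.trans h2) h.not_gt

lemma exists_mul_ne_zero {i : ℕ} (a : MvPolynomial ι ℝ ⧸ D.ideal) (ha : a ∈ D.piece i)
    (ha0 : a ≠ 0) : ∃ b ∈ D.piece (D.n - i), a * b ≠ 0 := by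
  classical
  rw [piece_eq_downSpan, downSpan, Finsupp.mem_span_image_iff_linearCombination] at ha
  obtain ⟨l, hl, rfl⟩ := ha
  have hl0 : l.support.Nonempty := by
    rw [Finsupp.support_nonempty_iff]
    rintro rfl
    simp at ha0
  obtain ⟨w, hw, hmin⟩ := Finset.exists_min_image l.support D.height hl0
  have hwi : (D.down w).card = i := (Finsupp.mem_supported _ _).1 hl hw
  refine ⟨D.cls (∏ F ∈ D.up w, X F), ?_, ?_⟩
  · have := D.cls_prod_mem_piece (D.up w)
    rwa [show (D.up w).card = D.n - i by have := D.card_down_add_card_up w; omega] at this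
  · rw [Finsupp.linearCombination_apply, Finsupp.sum, Finset.sum_mul,
      Finset.sum_eq_single_of_mem w hw, smul_mul_assoc, ← map_mul, prod_down_mul_prod_up]
    · exact smul_ne_zero (by simpa using hw) (D.cls_prod_inc_ne_zero w)
    · intro v hv hne
      rw [smul_mul_assoc, D.cls_down_mul_cls_up_eq_zero hne (hmin v hv), smul_zero]

end SimpleFan

section FacetGeometry

lemma IsExposed.eq_convexHull_inter {A F : Set V} (hA : A.Finite)
    (hF : IsExposed ℝ (convexHull ℝ A) F) : F = convexHull ℝ (A ∩ F) := by
  have hconv : Convex ℝ F := hF.convex (convex_convexHull ℝ A)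
  refine Set.Subset.antisymm ?_ (convexHull_min Set.inter_subset_right hconv)
  have hsub : F.extremePoints ℝ ⊆ A ∩ F := fun x hx =>
    ⟨extremePoints_convexHull_subset (hF.isExtreme.extremePoints_subset_extremePoints hx), hx.1⟩
  conv_lhs => rw [← closure_convexHull_extremePoints (hF.isCompact (hA.isCompact_convexHull ℝ))
    hconv]
  exact closure_minimal (convexHull_mono hsub) ((hA.inter_of_left F).isClosed_convexHull ℝ)

lemma finite_facets {Q A : Set V} (hA : A.Finite) (hQ : Q = convexHull ℝ A) :
    Finite (Facets Q) := by
  subst hQ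
  have : Finite (𝒫 A) := hA.finite_subsets
  refine Finite.of_injective (fun F : Facets (convexHull ℝ A) => (⟨A ∩ F.1,
    Set.inter_subset_left⟩ : 𝒫 A)) fun F G h => Subtype.ext ?_
  rw [F.2.1.eq_convexHull_inter hA, G.2.1.eq_convexHull_inter hA,
    show A ∩ F.1 = A ∩ G.1 from Subtype.ext_iff.1 h]

lemma inner_lt_of_mem_interior {Q : Set V} {p z u : V} (hp : p ∈ interior Q) (hu : u ≠ 0)
    (hz : ∀ y ∈ Q, ⟪u, y⟫ ≤ ⟪u, z⟫) : ⟪u, p⟫ < ⟪u, z⟫ := by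
  have hc : Continuous fun ε : ℝ => p + ε • u := by fun_prop
  have h0 : ∀ᶠ ε : ℝ in nhds 0, p + ε • u ∈ Q :=
    hc.continuousAt.eventually (by simpa using mem_interior_iff_mem_nhds.1 hp)
  obtain ⟨ε, h1, h2⟩ := ((h0.filter_mono nhdsWithin_le_nhds).and
    (self_mem_nhdsWithin (s := Set.Ioi (0 : ℝ)))).exists
  have h3 := hz _ h1
  rw [inner_add_right, inner_smul_right] at h3
  have h4 : 0 < ε * ⟪u, u⟫ := mul_pos h2 (real_inner_self_pos.2 hu)
  linarith

lemma affineSpan_direction_eq_top {Q : Set V} (hfull : (interior Q).Nonempty) :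
    (affineSpan ℝ Q).direction = ⊤ := by
  have : affineSpan ℝ Q = ⊤ := affineSpan_eq_top_of_nonempty_interior
    (hfull.mono (interior_mono (subset_convexHull ℝ Q)))
  rw [this, AffineSubspace.direction_top]

lemma isOutwardNormal_normalVec [FiniteDimensional ℝ V] {Q F : Set V}
    (hfull : (interior Q).Nonempty) (hF : IsFacet Q F) (hne : F.Nonempty) :
    IsOutwardNormal Q F (normalVec Q F) := by
  have h : ∃ u : V, IsOutwardNormal Q F u := by
    obtain ⟨l, hl⟩ := hF.1 hne
    set w := (InnerProductSpace.toDual ℝ V).symm l with hw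
    have hlw : ∀ x, l x = ⟪w, x⟫ := fun x => by simp [hw]
    simp only [hlw] at hl
    have hw0 : w ≠ 0 := by
      intro h0
      have hFQ : F = Q := by rw [hl]; ext x; simp [h0]
      have := hF.2
      rw [hFQ, affineSpan_direction_eq_top hfull, finrank_top] at this
      omega
    refine ⟨‖w‖⁻¹ • w, norm_smul_inv_norm hw0, ?_⟩
    have hpos : 0 < ‖w‖⁻¹ := inv_pos.2 (norm_pos_iff.2 hw0)
    conv_lhs => rw [hl]
    ext x
    simp only [Set.mem_ofPred_eq, inner_smul_left, conj_trivial, mul_le_mul_iff_right₀ hpos]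
  rw [normalVec, dif_pos h]
  exact h.choose_spec

lemma normalVec_empty {Q : Set V} (hne : Q.Nonempty) (hc : IsCompact Q) :
    normalVec Q ∅ = 0 := by
  rw [normalVec, dif_neg]
  rintro ⟨u, -, hu⟩
  obtain ⟨m, hm, hmax⟩ := hc.exists_isMaxOn hne
    (f := fun x => ⟪u, x⟫) (by fun_prop : Continuous fun x : V => ⟪u, x⟫).continuousOn
  have : m ∈ (∅ : Set V) := by
    rw [hu]
    exact ⟨hm, fun y hy => hmax hy⟩
  exact this

lemma exists_mem_interior_forall_notMem [FiniteDimensional ℝ V] {Q : Set V}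
    (hfull : (interior Q).Nonempty) {κ : Type*} [Finite κ] (L : κ → AffineSubspace ℝ V) :
    ∃ p ∈ interior Q, ∀ k, p ∈ L k → L k = ⊤ := by
  let _ : MeasurableSpace V := borel V
  have : BorelSpace V := ⟨rfl⟩
  by_contra! h
  have hsub : interior Q ⊆ ⋃ k : {k // L k ≠ ⊤}, (L k.1 : Set V) := fun p hp => by
    obtain ⟨k, hk, hk'⟩ := h p hp
    exact Set.mem_iUnion.2 ⟨⟨k, hk'⟩, hk⟩
  let μ : MeasureTheory.Measure V := MeasureTheory.Measure.addHaar
  have h0 : μ (⋃ k : {k // L k ≠ ⊤}, (L k.1 : Set V)) = 0 :=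
    MeasureTheory.measure_iUnion_null fun k =>
      MeasureTheory.Measure.addHaar_affineSubspace μ _ k.2
  exact (isOpen_interior.measure_pos μ hfull).ne' (MeasureTheory.measure_mono_null hsub h0)

lemma exists_facet_of_notMem [FiniteDimensional ℝ V] {Q A : Set V} (hA : A.Finite)
    (hQ : Q = convexHull ℝ A) (hfull : (interior Q).Nonempty) {x : V} (hx : x ∉ Q) :
    ∃ F, IsFacet Q F ∧ ∃ p ∈ interior Q, ∃ t : ℝ, 0 ≤ t ∧ t < 1 ∧ p + t • (x - p) ∈ F := by
  have hcomp : IsCompact Q := hQ ▸ hA.isCompact_convexHull ℝ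
  have hconv : Convex ℝ Q := hQ ▸ convex_convexHull ℝ A
  have : Finite (𝒫 A) := hA.finite_subsets
  obtain ⟨p, hp, hgen⟩ := exists_mem_interior_forall_notMem hfull
    fun B : 𝒫 A => affineSpan ℝ (insert x B.1)
  have hcont : Continuous fun t : ℝ => p + t • (x - p) := by fun_prop
  have hTc : IsCompact (Set.Icc (0 : ℝ) 1 ∩ (fun t : ℝ => p + t • (x - p)) ⁻¹' Q) :=
    isCompact_Icc.inter_right (hcomp.isClosed.preimage hcont)
  obtain ⟨t, ⟨⟨ht0, ht1⟩, htQ⟩, hmax⟩ := hTc.exists_isMaxOn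
    ⟨0, by simp, by simpa using interior_subset hp⟩ continuousOn_id
  have ht1 : t < 1 := ht1.lt_of_ne fun h => hx (by simpa [h] using htQ)
  set z := p + t • (x - p) with hz
  have hzint : z ∉ interior Q := fun hzi => by
    have h0 : ∀ᶠ s : ℝ in nhds t, p + s • (x - p) ∈ Q :=
      hcont.continuousAt.eventually (mem_interior_iff_mem_nhds.1 hzi)
    obtain ⟨s, ⟨h1, h2⟩, h3⟩ := (((h0.and (eventually_lt_nhds ht1)).filter_mono
      nhdsWithin_le_nhds).and (self_mem_nhdsWithin (s := Set.Ioi t))).exists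
    have h3 : t < s := h3
    exact absurd (hmax ⟨⟨by linarith, h2.le⟩, h1⟩) (not_le.2 h3)
  obtain ⟨f, hf0, hfz⟩ := geometric_hahn_banach_of_nonempty_interior_point hconv hzint hfull
  set G : Set V := {x ∈ Q | ∀ y ∈ Q, f y ≤ f x} with hG
  have hzG : z ∈ G := ⟨htQ, hfz⟩
  have hexp : IsExposed ℝ Q G := fun _ => ⟨f, rfl⟩
  have hGA : G = convexHull ℝ (A ∩ G) := IsExposed.eq_convexHull_inter hA (hQ ▸ hexp)
  have hspan : affineSpan ℝ G = affineSpan ℝ (A ∩ G) := by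
    conv_lhs => rw [hGA, affineSpan_convexHull]
  have htop : affineSpan ℝ (insert x (A ∩ G)) = ⊤ := by
    refine hgen ⟨A ∩ G, Set.inter_subset_left⟩ ?_
    have hxm : x ∈ affineSpan ℝ (insert x (A ∩ G)) :=
      subset_affineSpan ℝ _ (Set.mem_insert x _)
    have hzm : z ∈ affineSpan ℝ (insert x (A ∩ G)) :=
      affineSpan_mono ℝ (Set.subset_insert x _) (hspan ▸ subset_affineSpan ℝ G hzG)
    have hpm := AffineMap.lineMap_mem (1 - t)⁻¹ hxm hzm
    have h1t : 1 - t ≠ 0 := by linarith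
    have h2 : z - x = (1 - t) • (p - x) := by rw [hz]; module
    rwa [AffineMap.lineMap_apply, vsub_eq_sub, h2, smul_smul, inv_mul_cancel₀ h1t, one_smul,
      vadd_eq_add, sub_add_cancel] at hpm
  refine ⟨G, ⟨hexp, le_antisymm ?_ ?_⟩, p, hp, t, ht0, ht1, hzG⟩
  · have hf0' : f.toLinearMap ≠ 0 := fun h => hf0 (ContinuousLinearMap.coe_injective h)
    rw [← Module.Dual.finrank_ker_add_one_of_ne_zero hf0']
    refine Nat.add_le_add_right (Submodule.finrank_mono ?_) 1
    rw [direction_affineSpan, vectorSpan_def, Submodule.span_le]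
    rintro _ ⟨a, ha, b, hb, rfl⟩
    have : f a = f b := le_antisymm (hb.2 a ha.1) (ha.2 b hb.1)
    simp [this]
  · have h := finrank_vectorSpan_insert_le_set ℝ (A ∩ G) x
    rwa [← direction_affineSpan, htop, AffineSubspace.direction_top, finrank_top,
      ← direction_affineSpan, ← hspan] at h

lemma exists_facet_inner_lt [FiniteDimensional ℝ V] {Q A : Set V} (hA : A.Finite)
    (hQ : Q = convexHull ℝ A) (hfull : (interior Q).Nonempty) {x : V} (hx : x ∉ Q) :
    ∃ F, IsFacet Q F ∧ ∃ z ∈ F, ⟪normalVec Q F, z⟫ < ⟪normalVec Q F, x⟫ := by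
  obtain ⟨F, hF, p, hp, t, ht0, ht1, hz⟩ := exists_facet_of_notMem hA hQ hfull hx
  refine ⟨F, hF, _, hz, ?_⟩
  obtain ⟨hu, hFu⟩ := isOutwardNormal_normalVec hfull hF ⟨_, hz⟩
  set u := normalVec Q F
  have hu0 : u ≠ 0 := by
    rintro h
    simp [h] at hu
  have h := inner_lt_of_mem_interior hp hu0 (hFu ▸ hz : _ ∈ {x ∈ Q | ∀ y ∈ Q, ⟪u, y⟫ ≤ ⟪u, x⟫}).2
  rw [inner_add_right, inner_smul_right, inner_sub_right] at h ⊢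
  have h1 : 0 < ⟪u, x⟫ - ⟪u, p⟫ := by
    by_contra! h2
    nlinarith
  nlinarith

lemma exists_halfspace_representation [FiniteDimensional ℝ V] {Q A : Set V} (hA : A.Finite)
    (hQ : Q = convexHull ℝ A) (hfull : (interior Q).Nonempty) :
    ∃ h : Facets Q → ℝ, (∀ F : Facets Q, F.1 = {x ∈ Q | ⟪normalVec Q F.1, x⟫ = h F}) ∧
      Q = HPolytope.poly (fun F : Facets Q => normalVec Q F.1) h := by
  have hcomp : IsCompact Q := hQ ▸ hA.isCompact_convexHull ℝ
  have hne : Q.Nonempty := hfull.mono interior_subset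
  have key : ∀ F : Facets Q, ∃ c : ℝ, F.1 = {x ∈ Q | ⟪normalVec Q F.1, x⟫ = c} ∧
      ∀ x ∈ Q, ⟪normalVec Q F.1, x⟫ ≤ c := by
    intro F
    obtain h0 | ⟨z, hz⟩ := F.1.eq_empty_or_nonempty
    · refine ⟨1, ?_, ?_⟩
      · rw [h0, normalVec_empty hne hcomp]
        simp
      · rw [h0, normalVec_empty hne hcomp]
        simp
    · obtain ⟨-, hFu⟩ := isOutwardNormal_normalVec hfull F.2 ⟨z, hz⟩
      set u := normalVec Q F.1
      rw [hFu] at hz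
      refine ⟨⟪u, z⟫, ?_, hz.2⟩
      rw [hFu]
      ext x
      exact and_congr_right fun hx => ⟨fun h => le_antisymm (hz.2 x hx) (h z hz.1),
        fun h y hy => h ▸ hz.2 y hy⟩
  choose h h1 h2 using key
  refine ⟨h, h1, Set.Subset.antisymm (fun x hx F => h2 F x hx) fun x hx => ?_⟩
  by_contra hxQ
  obtain ⟨F, hF, z, hz, hlt⟩ := exists_facet_inner_lt hA hQ hfull hxQ
  have hz' : z ∈ {x ∈ Q | ⟪normalVec Q F, x⟫ = h ⟨F, hF⟩} := (h1 ⟨F, hF⟩).subset hz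
  have := hx ⟨F, hF⟩
  rw [← hz'.2] at this
  exact absurd hlt (not_lt.2 this)

end FacetGeometry

lemma SimpleFan.poincareDuality {ι κ U : Type*} [Fintype ι] [DecidableEq ι] [Fintype κ]
    (D : SimpleFan ι κ U) {K : Ideal (MvPolynomial ι ℝ)} (hK : D.ideal = K)
    (P : ℕ → Submodule ℝ (MvPolynomial ι ℝ ⧸ K))
    (hP : ∀ i, P i = (MvPolynomial.homogeneousSubmodule ι ℝ i).map
      (Ideal.Quotient.mkₐ ℝ K).toLinearMap) :
    (∀ i, D.n < i → P i = ⊥) ∧ Module.finrank ℝ (P D.n) = 1 ∧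
      ∀ i, i ≤ D.n → ∀ a ∈ P i, a ≠ 0 → ∃ b ∈ P (D.n - i), a * b ≠ 0 := by
  subst hK
  obtain rfl : P = D.piece := funext hP
  exact ⟨fun i hi => D.piece_eq_bot hi, D.finrank_piece_top,
    fun i _ a ha ha0 => D.exists_mul_ne_zero a ha ha0⟩

lemma HPolytope.exists_simpleFan {V ι : Type*} [NormedAddCommGroup V] [InnerProductSpace ℝ V]
    [FiniteDimensional ℝ V] [Fintype ι] [DecidableEq ι] {ℓ : ι → V} {h : ι → ℝ} {P : Set V}
    (hP : P = poly ℓ h) (hc : IsCompact P) (hne : P.Nonempty) [Fintype (P.extremePoints ℝ)]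
    (hcard : ∀ v ∈ P.extremePoints ℝ, (active ℓ h v).card = Module.finrank ℝ V) :
    ∃ D : SimpleFan ι (P.extremePoints ℝ) V, D.n = Module.finrank ℝ V ∧
      (∀ v, D.inc v = active ℓ h v.1) ∧ ∀ u i, D.coeff u i = ⟪u, ℓ i⟫ := by
  subst hP
  choose! e he using fun v (hv : v ∈ (poly ℓ h).extremePoints ℝ) => exists_isDual hv (hcard v hv)
  have he0 : ∀ v ∈ (poly ℓ h).extremePoints ℝ, ∀ i ∈ active ℓ h v, e v i ≠ 0 := by
    intro v hv i hi h0
    simpa [h0] using (he v hv).inner_eq i hi i hi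
  obtain ⟨y, hy⟩ := exists_generic
    (fun k : (v : (poly ℓ h).extremePoints ℝ) × active ℓ h v.1 => e k.1 k.2)
    fun k => he0 _ k.1.2 _ k.2.2
  have hy' : ∀ v ∈ (poly ℓ h).extremePoints ℝ, ∀ i ∈ active ℓ h v, ⟪e v i, y⟫ ≠ 0 :=
    fun v hv i hi => hy ⟨⟨v, hv⟩, ⟨i, hi⟩⟩
  obtain ⟨v₀, hv₀⟩ := hc.extremePoints_nonempty hne
  refine ⟨{
    n := Module.finrank ℝ V
    inc := fun v => active ℓ h v.1
    coeff := fun u i => ⟪u, ℓ i⟫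
    e := fun v => e v
    wt := fun v i => ⟪e v i, y⟫
    θ := fun u => ⟪u, y⟫
    c := fun v => (vol ℓ (active ℓ h v.1))⁻¹
    height := fun v => ⟪v.1, y⟫
    vertex := ⟨v₀, hv₀⟩
    card_inc := fun v => hcard v v.2
    coeff_e := fun v => (he v v.2).inner_eq
    expand := fun v u => by
      conv_rhs => rw [← (he v v.2).expand u]
      simp [sum_inner, inner_smul_left]
    wt_ne_zero := fun v => hy' v v.2
    c_ne_zero := fun v => inv_ne_zero (vol_ne_zero (hcard v v.2) (he v v.2))
    exists_min := fun t v ht => by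
      obtain ⟨w, hw, h1, h2⟩ := exists_min_vertex hc t y he v.2.1 ht
      exact ⟨⟨w, hw⟩, h1, h2⟩
    lower := fun v w hd =>
      (eq_or_inner_lt (he v v.2) (hy' v v.2) w.2.1 hd).imp_left Subtype.ext
    upper := fun v w hd => by
      have := eq_or_inner_lt (y := -y) (he v v.2) (fun i hi => by simpa using hy' v v.2 i hi)
        w.2.1 fun i hi hpos => hd i hi (by simpa using hpos)
      simpa [Subtype.ext_iff] using this
    edge := fun t ht => by
      convert edge_sum_eq_zero hc hcard he hy' ht }, rfl, fun _ => rfl, fun _ _ => rfl⟩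

lemma exists_simpleFan_ideal_eq_polyIdeal [FiniteDimensional ℝ V] {Q A : Set V} (hA : A.Finite)
    (hQ : Q = convexHull ℝ A) (hfull : (interior Q).Nonempty) (hsimple : IsSimple Q)
    [Fintype (Facets Q)] [DecidableEq (Facets Q)] [Fintype (Q.extremePoints ℝ)] :
    ∃ D : SimpleFan (Facets Q) (Q.extremePoints ℝ) V,
      D.n = Module.finrank ℝ V ∧ D.ideal = polyIdeal Q := by
  obtain ⟨h, hF, hQh⟩ := exists_halfspace_representation hA hQ hfull
  set ℓ : Facets Q → V := fun F => normalVec Q F.1 with hℓ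
  have hcomp : IsCompact Q := hQ ▸ hA.isCompact_convexHull ℝ
  have hne : Q.Nonempty := hfull.mono interior_subset
  have hact : ∀ v ∈ Q, ∀ F : Facets Q, F ∈ HPolytope.active ℓ h v ↔ v ∈ F.1 := by
    intro v hv F
    rw [HPolytope.mem_active, hF F]
    exact ⟨fun h => ⟨hv, h⟩, fun h => h.2⟩
  have hcard : ∀ v ∈ Q.extremePoints ℝ,
      (HPolytope.active ℓ h v).card = Module.finrank ℝ V := by
    intro v hv
    rw [← hsimple v hv, ← Set.ncard_coe_finset,
      ← Set.ncard_image_of_injective _ (Subtype.val_injective (p := IsFacet Q))]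
    congr 1
    ext F
    simp only [Set.mem_image, Finset.mem_coe, Set.mem_ofPred_eq, hact v hv.1]
    exact ⟨fun ⟨G, h1, h2⟩ => h2 ▸ ⟨G.2, h1⟩, fun ⟨h1, h2⟩ => ⟨⟨F, h1⟩, h2, rfl⟩⟩
  have hinter : ∀ t : Finset (Facets Q), (⋂ F ∈ t, (F.1 : Set V)) = ∅ ↔
      ∀ v ∈ Q.extremePoints ℝ, ¬ t ⊆ HPolytope.active ℓ h v := by
    intro t
    simp only [Set.eq_empty_iff_forall_notMem, Set.mem_iInter₂]
    refine ⟨fun H v hv ht => H v fun F hFt => (hact v hv.1 F).1 (ht hFt), fun H x hx => ?_⟩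
    obtain ⟨x₀, hx₀, ht⟩ : ∃ x₀ ∈ Q, t ⊆ HPolytope.active ℓ h x₀ := by
      obtain rfl | ⟨F, hFt⟩ := t.eq_empty_or_nonempty
      · exact ⟨_, hne.some_mem, Finset.empty_subset _⟩
      · have hxQ : x ∈ Q := ((hF F).subset (hx F hFt)).1
        exact ⟨x, hxQ, fun G hG => (hact x hxQ G).2 (hx G hG)⟩
    obtain ⟨w, hw, htw, -⟩ := HPolytope.exists_extreme_minimizer (hQh ▸ hcomp) t 0
      (hQh ▸ hx₀) ht
    exact H w (hQh ▸ hw) htw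
  obtain ⟨D, h1, h2, h3⟩ := HPolytope.exists_simpleFan hQh hcomp hne hcard
  refine ⟨D, h1, ?_⟩
  simp only [SimpleFan.ideal, SimpleFan.rel, polyIdeal, srIdeal, linIdeal, hinter, h2, h3,
    finsum_eq_sum_of_fintype, Subtype.forall, hℓ]

/-- Lemma 5.6: for a full-dimensional simple polytope `Q` in `V` with `dim V = n`,
the polytopal algebra `𝒜(Q)` is a Poincaré duality algebra of top degree `n`:
`𝒜^i(Q) = 0` for `i > n`, `dim_ℝ 𝒜^n(Q) = 1`, and the multiplication pairings
`𝒜^i(Q) × 𝒜^{n−i}(Q) → 𝒜^n(Q)` are non-degenerate. -/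
theorem statement_17 {V : Type*} [NormedAddCommGroup V] [InnerProductSpace ℝ V]
    [FiniteDimensional ℝ V] (hn : 1 ≤ Module.finrank ℝ V)
    (Q : Set V) (hQ : ∃ A : Set V, A.Finite ∧ Q = convexHull ℝ A)
    (hfull : (interior Q).Nonempty) (hsimple : IsSimple Q) :
    (∀ i : ℕ, Module.finrank ℝ V < i → gradePiece Q i = ⊥) ∧
    Module.finrank ℝ ↥(gradePiece Q (Module.finrank ℝ V)) = 1 ∧
    (∀ i : ℕ, i ≤ Module.finrank ℝ V → ∀ a ∈ gradePiece Q i, a ≠ 0 →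
      ∃ b ∈ gradePiece Q (Module.finrank ℝ V - i), a * b ≠ 0) := by
  classical
  obtain ⟨A, hA, hQA⟩ := hQ
  have := finite_facets hA hQA
  have : Finite (Q.extremePoints ℝ) :=
    (hA.subset (hQA ▸ extremePoints_convexHull_subset)).to_subtype
  have := Fintype.ofFinite (Facets Q)
  have := Fintype.ofFinite (Q.extremePoints ℝ)
  obtain ⟨D, hD, hK⟩ := exists_simpleFan_ideal_eq_polyIdeal hA hQA hfull hsimple
  rw [← hD]
  exact D.poincareDuality hK _ fun _ => rfl
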